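/- Let l, m, n be positive integers satisfying l + m ≥ n − 1, and put p = l + m − n + 1. Regard S^l as the unit sphere of the span of the first l+1 standard basis vectors of ℝ^n, and S^m as the unit sphere of the span of the first m+1 standard basis vectors of ℝ^n. Then for all Borel subsets A ⊆ S^m and B ⊆ S^l, ∫_{O(n)} σ_p(gB ∩ A) dH(g) = σ_l(B) · σ_m(A). -/

import Mathlib

open MeasureTheory Filter Real

noncomputable section

/-- The orthogonal group O(n) of ℝⁿ. -/
abbrev OG (n : ℕ) : Type := Matrix.orthogonalGroup (Fin n) ℝ

instance (n : ℕ) : MeasurableSpace (OG n) := borel _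
instance (n : ℕ) : BorelSpace (OG n) := ⟨rfl⟩

/-- The natural action of `g ∈ O(n)` on `ℝⁿ`. -/
def act {n : ℕ} (g : OG n) (x : EuclideanSpace ℝ (Fin n)) : EuclideanSpace ℝ (Fin n) :=
  Matrix.toEuclideanLin (g : Matrix (Fin n) (Fin n) ℝ) x

/-- `E_k`: the span of the first `k` standard basis vectors of `ℝⁿ`, as a set. -/
def Ek (n k : ℕ) : Set (EuclideanSpace ℝ (Fin n)) :=
  {x | ∀ i : Fin n, k ≤ (i : ℕ) → x i = 0}

/-- The `m`-dimensional face `{x : |xᵢ| ≤ 1 for i < m, xᵢ = 1 for i ≥ m}` of the cube `[-1,1]ⁿ`. -/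
def cubeFace (n m : ℕ) : Set (EuclideanSpace ℝ (Fin n)) :=
  {x | (∀ i : Fin n, (i : ℕ) < m → |x i| ≤ 1) ∧ ∀ i : Fin n, m ≤ (i : ℕ) → x i = 1}

/-- `f(j,k,n)`, the expected number of `j`-faces of a random `k`-section of the `n`-cube,
computed with respect to the probability measure `H` on `O(n)`. -/
def expFaces (n : ℕ) (H : Measure (OG n)) (j k : ℕ) : ℝ :=
  2 ^ (k - j) * (n.choose (k - j)) *
    (H {g | (act g '' Ek n k ∩ cubeFace n (n - k + j)).Nonempty}).toReal

/-- `H^p(S^p)`: the `p`-dimensional Hausdorff measure of the unit sphere `S^p ⊆ ℝ^{p+1}`. -/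
def sphereHaus (p : ℕ) : ENNReal :=
  (μH[(p : ℝ)] : Measure (EuclideanSpace ℝ (Fin (p + 1)))) (Metric.sphere 0 1)

/-- `σ_p(S) = H^p(S) / H^p(S^p)`, the normalized `p`-dimensional spherical measure. -/
def sigmaMeas (p : ℕ) {n : ℕ} (S : Set (EuclideanSpace ℝ (Fin n))) : ENNReal :=
  μH[(p : ℝ)] S / sphereHaus p


lemma act_one {n : ℕ} (x : EuclideanSpace ℝ (Fin n)) : act (1 : OG n) x = x := by
  simp [act, Matrix.toLpLin_one]

lemma act_mul {n : ℕ} (g h : OG n) (x : EuclideanSpace ℝ (Fin n)) :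
    act (g * h) x = act g (act h x) := by
  simp [act, Matrix.toLpLin_mul_same]

lemma act_inner {n : ℕ} (g : OG n) (x y : EuclideanSpace ℝ (Fin n)) :
    inner ℝ (act g x) (act g y) = inner ℝ x y := by
  have h1 : (g : Matrix (Fin n) (Fin n) ℝ).transpose * (g : Matrix (Fin n) (Fin n) ℝ) = 1 :=
    (Matrix.mem_orthogonalGroup_iff' _ _).1 g.2
  simp only [act, Matrix.toLpLin_apply, EuclideanSpace.inner_eq_star_dotProduct, star_trivial]
  rw [Matrix.dotProduct_mulVec, Matrix.vecMul_mulVec, h1, Matrix.vecMul_one]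

/-- the linear isometry attached to an orthogonal matrix -/
def isoOf {n : ℕ} (g : OG n) : EuclideanSpace ℝ (Fin n) ≃ₗᵢ[ℝ] EuclideanSpace ℝ (Fin n) :=
  LinearEquiv.isometryOfInner
    (LinearEquiv.ofLinearMap (Matrix.toEuclideanLin (g : Matrix (Fin n) (Fin n) ℝ))
      (Matrix.toEuclideanLin ((g⁻¹ : OG n) : Matrix (Fin n) (Fin n) ℝ))
      (by ext1 x; change act g (act g⁻¹ x) = x; rw [← act_mul]; simp [act_one])
      (by ext1 x; change act g⁻¹ (act g x) = x; rw [← act_mul]; simp [act_one]))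
    (fun x y => act_inner g x y)

@[simp] lemma isoOf_apply {n : ℕ} (g : OG n) (x : EuclideanSpace ℝ (Fin n)) :
    isoOf g x = act g x := rfl
@[simp] lemma isoOf_symm_apply {n : ℕ} (g : OG n) (x : EuclideanSpace ℝ (Fin n)) :
    (isoOf g).symm x = act g⁻¹ x := rfl

lemma act_act_inv {n : ℕ} (g : OG n) (x : EuclideanSpace ℝ (Fin n)) : act g (act g⁻¹ x) = x := by
  rw [← act_mul]; simp [act_one]
lemma act_inv_act {n : ℕ} (g : OG n) (x : EuclideanSpace ℝ (Fin n)) : act g⁻¹ (act g x) = x := by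
  rw [← act_mul]; simp [act_one]

lemma norm_act {n : ℕ} (g : OG n) (x : EuclideanSpace ℝ (Fin n)) : ‖act g x‖ = ‖x‖ :=
  (isoOf g).norm_map x

lemma act_smul {n : ℕ} (g : OG n) (c : ℝ) (x : EuclideanSpace ℝ (Fin n)) :
    act g (c • x) = c • act g x := (isoOf g).map_smul c x

lemma act_image_eq {n : ℕ} (g : OG n) (S : Set (EuclideanSpace ℝ (Fin n))) :
    act g '' S = act g⁻¹ ⁻¹' S := by
  ext x; constructor
  · rintro ⟨y, hy, rfl⟩; simpa [act_inv_act] using hy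
  · intro h; exact ⟨_, h, act_act_inv g x⟩

/-- the orthogonal matrix of an isometry -/
lemma exists_OG {n : ℕ} (f : EuclideanSpace ℝ (Fin n) ≃ₗᵢ[ℝ] EuclideanSpace ℝ (Fin n)) :
    ∃ g : OG n, ∀ x, act g x = f x := by
  refine ⟨⟨_, f.toMatrix_mem_unitaryGroup (EuclideanSpace.basisFun _ _)
    (EuclideanSpace.basisFun _ _)⟩, fun x => ?_⟩
  simp only [act, Matrix.toEuclideanLin_eq_toLin_orthonormal, Matrix.toLin_toMatrix]
  rfl

lemma continuous_act {n : ℕ} :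
    Continuous (fun q : OG n × EuclideanSpace ℝ (Fin n) => act q.1 q.2) := by
  simp only [act, Matrix.toLpLin_apply]
  apply (PiLp.continuous_toLp 2 _).comp
  exact (continuous_subtype_val.comp continuous_fst).matrix_mulVec
    ((PiLp.continuous_ofLp 2 _).comp continuous_snd)

lemma isometry_act {n : ℕ} (g : OG n) : Isometry (act g) := (isoOf g).isometry

lemma continuous_act_right {n : ℕ} (g : OG n) : Continuous (act g) := (isometry_act g).continuous

instance instSCT (n : ℕ) : SecondCountableTopology (OG n) := by
  have : SecondCountableTopology (Matrix (Fin n) (Fin n) ℝ) :=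
    inferInstanceAs (SecondCountableTopology (Fin n → Fin n → ℝ))
  exact TopologicalSpace.Subtype.secondCountableTopology _

instance instCompactOG (n : ℕ) : CompactSpace (OG n) := by
  refine (isCompact_iff_compactSpace (X := Matrix (Fin n) (Fin n) ℝ)
    (s := (Matrix.orthogonalGroup (Fin n) ℝ : Set (Matrix (Fin n) (Fin n) ℝ)))).1 ?_
  have hK : IsCompact (Set.univ.pi fun _ : Fin n => Set.univ.pi fun _ : Fin n =>
      Set.Icc (-1 : ℝ) 1) := isCompact_univ_pi fun _ => isCompact_univ_pi fun _ => isCompact_Icc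
  refine IsCompact.of_isClosed_subset hK ?_ ?_
  · have : (Matrix.orthogonalGroup (Fin n) ℝ : Set (Matrix (Fin n) (Fin n) ℝ)) =
        {A | A * A.transpose = 1} := by
      ext A; exact Matrix.mem_orthogonalGroup_iff _ _
    rw [this]
    exact isClosed_eq (by fun_prop) continuous_const
  · intro A hA i _ j _
    have h2 := entry_norm_bound_of_unitary (𝕜 := ℝ) hA i j
    rw [Real.norm_eq_abs, abs_le] at h2
    exact h2

lemma right_inv {G : Type*} [Group G] [TopologicalSpace G] [IsTopologicalGroup G] [CompactSpace G]
    [MeasurableSpace G] [BorelSpace G] (H : Measure G) [H.IsHaarMeasure] [IsProbabilityMeasure H] :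
    H.IsMulRightInvariant := by
  constructor
  intro g
  have : IsProbabilityMeasure (H.map (· * g)) :=
    Measure.isProbabilityMeasure_map (by fun_prop)
  have : (H.map (· * g)).IsHaarMeasure := inferInstance
  exact Measure.isHaarMeasure_eq_of_isProbabilityMeasure _ _

/-- uniqueness of invariant measures on the unit sphere of a subspace -/
def unitS {n : ℕ} (W : Submodule ℝ (EuclideanSpace ℝ (Fin n))) : Set (EuclideanSpace ℝ (Fin n)) :=
  (W : Set (EuclideanSpace ℝ (Fin n))) ∩ Metric.sphere 0 1

/-- stabilizer of a subspace. -/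
def stab {n : ℕ} (W : Submodule ℝ (EuclideanSpace ℝ (Fin n))) : Subgroup (OG n) where
  carrier := {g | ∀ x, act g x ∈ W ↔ x ∈ W}
  mul_mem' := by
    intro a b ha hb x
    rw [act_mul]; exact (ha _).trans (hb _)
  one_mem' := by intro x; rw [act_one]
  inv_mem' := by
    intro a ha x
    rw [← ha, act_act_inv]

lemma mem_stab {n : ℕ} {W : Submodule ℝ (EuclideanSpace ℝ (Fin n))} {g : OG n} :
    g ∈ stab W ↔ ∀ x, act g x ∈ W ↔ x ∈ W := Iff.rfl

lemma isClosed_stab {n : ℕ} (W : Submodule ℝ (EuclideanSpace ℝ (Fin n))) :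
    IsClosed (stab W : Set (OG n)) := by
  have : (stab W : Set (OG n)) = ⋂ x ∈ W, ({g | act g x ∈ W} ∩ {g | act g⁻¹ x ∈ W}) := by
    ext g
    simp only [SetLike.mem_coe, mem_stab, Set.mem_iInter, Set.mem_inter_iff, Set.mem_ofPred_eq]
    constructor
    · intro h x hx
      refine ⟨(h x).2 hx, ?_⟩
      rw [← h, act_act_inv]; exact hx
    · intro h x
      refine ⟨fun hx => ?_, fun hx => (h x hx).1⟩
      have := (h _ hx).2
      rwa [act_inv_act] at this
  rw [this]
  refine isClosed_biInter fun x _ => IsClosed.inter ?_ ?_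
  · exact W.closed_of_finiteDimensional.preimage
      (continuous_act.comp (continuous_id.prodMk continuous_const))
  · exact W.closed_of_finiteDimensional.preimage
      (continuous_act.comp (continuous_inv.prodMk continuous_const))

lemma stab_transitive {n : ℕ} {W : Submodule ℝ (EuclideanSpace ℝ (Fin n))}
    {x y : EuclideanSpace ℝ (Fin n)} (hx : x ∈ unitS W) (hy : y ∈ unitS W) :
    ∃ g ∈ stab W, act g x = y := by
  obtain ⟨g, hg⟩ := exists_OG (Submodule.reflection (Submodule.span ℝ {x - y})ᗮ)
  have hmem : ∀ z ∈ W, act g z ∈ W := by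
    intro z hz
    rw [hg, Submodule.reflection_orthogonal_apply]
    apply W.neg_mem
    rw [Submodule.reflection_apply]
    refine W.sub_mem (W.smul_of_tower_mem (2 : ℕ) ?_) hz
    have h1 : Submodule.span ℝ {x - y} ≤ W := by
      rw [Submodule.span_singleton_le_iff_mem]; exact W.sub_mem hx.1 hy.1
    exact h1 (Submodule.starProjection_apply_mem _ _)
  have hinv : ∀ z, act g (act g z) = z := by
    intro z; rw [hg, hg]; exact Submodule.reflection_reflection _ _
  refine ⟨g, fun z => ⟨fun h => ?_, hmem z⟩, ?_⟩
  · have := hmem _ h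
    rwa [hinv] at this
  · rw [hg]
    apply Submodule.reflection_sub
    have h1 := hx.2; have h2 := hy.2
    simp at h1 h2
    rw [h1, h2]

lemma unique_aux {n : ℕ} (W : Submodule ℝ (EuclideanSpace ℝ (Fin n)))
    (H : Measure (stab W)) [IsProbabilityMeasure H] [H.IsHaarMeasure]
    (μ : Measure (EuclideanSpace ℝ (Fin n))) [IsFiniteMeasure μ]
    (h0 : μ (unitS W)ᶜ = 0)
    (hinv : ∀ g ∈ stab W, ∀ C, MeasurableSet C → μ (act g ⁻¹' C) = μ C)
    (e : EuclideanSpace ℝ (Fin n)) (he : e ∈ unitS W)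
    (C : Set (EuclideanSpace ℝ (Fin n))) (hC : MeasurableSet C) :
    μ C = μ Set.univ * H {g | act (g : OG n) e ∈ C} := by
  have : CompactSpace (stab W) := isCompact_iff_compactSpace.1 (isClosed_stab W).isCompact
  have := right_inv H
  have hc : Continuous (fun q : stab W × EuclideanSpace ℝ (Fin n) => act (q.1 : OG n) q.2) :=
    continuous_act.comp ((continuous_subtype_val.comp continuous_fst).prodMk continuous_snd)
  have hS : MeasurableSet ((fun q : stab W × EuclideanSpace ℝ (Fin n) => act (q.1 : OG n) q.2) ⁻¹' C) :=
    hc.measurable hC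
  have e1 := Measure.prod_apply (μ := H) (ν := μ) hS
  have e2 := Measure.prod_apply_symm (μ := H) (ν := μ) hS
  have e3 : ∀ g : stab W, μ (Prod.mk g ⁻¹' ((fun q : stab W × EuclideanSpace ℝ (Fin n) => act (q.1 : OG n) q.2) ⁻¹' C)) = μ C :=
    fun g => hinv g g.2 C hC
  simp_rw [e3] at e1
  simp only [lintegral_const, measure_univ, mul_one] at e1
  rw [← e1, e2]
  have h0' : ∀ᵐ x ∂μ, x ∈ unitS W := by
    rw [ae_iff]; exact h0
  have : ∀ᵐ x ∂μ, H ((fun g => (g, x)) ⁻¹' ((fun q : stab W × EuclideanSpace ℝ (Fin n) => act (q.1 : OG n) q.2) ⁻¹' C)) = H {g | act (g : OG n) e ∈ C} := by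
    filter_upwards [h0'] with x hx
    obtain ⟨k, hk, rfl⟩ := stab_transitive he hx
    have := measure_preimage_mul_right H ⟨k, hk⟩ {g | act (g : OG n) e ∈ C}
    rw [← this]
    congr 1
    ext g
    simp [act_mul]
  rw [lintegral_congr_ae this, lintegral_const, mul_comm]

lemma unique_inv {n : ℕ} (W : Submodule ℝ (EuclideanSpace ℝ (Fin n)))
    (μ ν : Measure (EuclideanSpace ℝ (Fin n))) [IsFiniteMeasure μ] [IsFiniteMeasure ν]
    (h0 : μ (unitS W)ᶜ = 0) (h0' : ν (unitS W)ᶜ = 0)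
    (hinv : ∀ g ∈ stab W, ∀ C, MeasurableSet C → μ (act g ⁻¹' C) = μ C)
    (hinv' : ∀ g ∈ stab W, ∀ C, MeasurableSet C → ν (act g ⁻¹' C) = ν C)
    (C : Set (EuclideanSpace ℝ (Fin n))) (hC : MeasurableSet C) :
    μ C * ν Set.univ = ν C * μ Set.univ := by
  by_cases hne : (unitS W).Nonempty
  · obtain ⟨e, he⟩ := hne
    have : CompactSpace (stab W) := isCompact_iff_compactSpace.1 (isClosed_stab W).isCompact
    let H : Measure (stab W) := Measure.haarMeasure ⊤
    have : IsProbabilityMeasure H := ⟨by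
      have := Measure.haarMeasure_self (K₀ := (⊤ : TopologicalSpace.PositiveCompacts (stab W)))
      simpa using this⟩
    rw [unique_aux W H μ h0 hinv e he C hC, unique_aux W H ν h0' hinv' e he C hC]
    ring
  · rw [Set.not_nonempty_iff_eq_empty] at hne
    rw [hne, Set.compl_empty] at h0 h0'
    simp [h0, h0']

lemma proj_orth_unit {V : Type*} [NormedAddCommGroup V] [InnerProductSpace ℝ V]
    [FiniteDimensional ℝ V] {x : V} (hx : ‖x‖ = 1) (y : V) :
    (((Submodule.span ℝ {x})ᗮ.orthogonalProjectionOnto y : (Submodule.span ℝ {x})ᗮ) : V)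
      = y - inner ℝ x y • x := by
  rw [← Submodule.starProjection_apply, Submodule.starProjection_orthogonal_val,
    Submodule.starProjection_unit_singleton ℝ hx]

lemma cap_dist {V : Type*} [NormedAddCommGroup V] [InnerProductSpace ℝ V]
    {x y z : V} (hx : ‖x‖ = 1) (hy : ‖y‖ = 1) (hz : ‖z‖ = 1)
    (hxy : 1 / 2 < inner ℝ x y) (hxz : 1 / 2 < inner ℝ x z) :
    ‖y - z‖ ≤ 3 * ‖(y - inner ℝ x y • x) - (z - inner ℝ x z • x)‖ := by
  set a := inner ℝ x y with ha
  set b := inner ℝ x z with hb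
  set u := y - a • x with hu
  set v := z - b • x with hv
  have hxx : inner ℝ x x = (1 : ℝ) := by rw [real_inner_self_eq_norm_sq, hx]; norm_num
  have nu : ‖u‖ ^ 2 = 1 - a ^ 2 := by
    rw [← real_inner_self_eq_norm_sq, hu]
    simp only [inner_sub_left, inner_sub_right, inner_smul_left, inner_smul_right, hxx,
      real_inner_comm x y, ← ha, real_inner_self_eq_norm_sq y, hy]
    simp; ring
  have nv : ‖v‖ ^ 2 = 1 - b ^ 2 := by
    rw [← real_inner_self_eq_norm_sq, hv]
    simp only [inner_sub_left, inner_sub_right, inner_smul_left, inner_smul_right, hxx,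
      real_inner_comm x z, ← hb, real_inner_self_eq_norm_sq z, hz]
    simp; ring
  have u1 : ‖u‖ ≤ 1 := by nlinarith [sq_nonneg a, norm_nonneg u]
  have v1 : ‖v‖ ≤ 1 := by nlinarith [sq_nonneg b, norm_nonneg v]
  have h1 : |‖u‖ - ‖v‖| ≤ ‖u - v‖ := abs_norm_sub_norm_le u v
  have h2 : |a - b| * (a + b) ≤ 2 * ‖u - v‖ := by
    have e : |a - b| * (a + b) = |‖u‖ - ‖v‖| * (‖u‖ + ‖v‖) := by
      have p1 : 0 < a + b := by linarith
      have p2 : 0 ≤ ‖u‖ + ‖v‖ := by positivity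
      rw [← abs_of_pos p1, ← abs_mul, ← abs_of_nonneg p2, ← abs_mul]
      rw [show (‖u‖ - ‖v‖) * (‖u‖ + ‖v‖) = -((a - b) * (a + b)) by nlinarith, abs_neg]
    rw [e]
    nlinarith [norm_nonneg u, norm_nonneg v, abs_nonneg (‖u‖ - ‖v‖)]
  have h3 : |a - b| ≤ 2 * ‖u - v‖ := by nlinarith [abs_nonneg (a - b)]
  have h4 : y - z = (u - v) + (a - b) • x := by
    rw [hu, hv, sub_smul]; abel
  calc ‖y - z‖ ≤ ‖u - v‖ + ‖(a - b) • x‖ := by rw [h4]; exact norm_add_le _ _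
    _ = ‖u - v‖ + |a - b| := by rw [norm_smul, hx, mul_one, Real.norm_eq_abs]
    _ ≤ 3 * ‖u - v‖ := by linarith

lemma cap_finite (p : ℕ) (x : EuclideanSpace ℝ (Fin (p + 1))) (hx : ‖x‖ = 1) :
    (μH[(p : ℝ)] : Measure (EuclideanSpace ℝ (Fin (p + 1))))
      {y | ‖y‖ = 1 ∧ 1 / 2 < inner ℝ x y} < ⊤ := by
  set U := {y : EuclideanSpace ℝ (Fin (p + 1)) | ‖y‖ = 1 ∧ 1 / 2 < inner ℝ x y} with hU
  set K := (Submodule.span ℝ {x})ᗮ with hK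
  have : Fact (Module.finrank ℝ (EuclideanSpace ℝ (Fin (p + 1))) = p + 1) := ⟨by simp⟩
  have hx0 : x ≠ 0 := by rintro rfl; simp at hx
  have hfr : Module.finrank ℝ K = p := Submodule.finrank_orthogonal_span_singleton hx0
  have hH : (μH[(p : ℝ)] : Measure K).IsAddHaarMeasure := by
    have := isAddHaarMeasure_hausdorffMeasure (E := K)
    rwa [hfr] at this
  let f : U → K := fun y => K.orthogonalProjectionOnto (y : EuclideanSpace ℝ (Fin (p + 1)))
  have hf : AntilipschitzWith 3 f := by
    refine AntilipschitzWith.of_le_mul_dist fun y z => ?_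
    rw [Subtype.dist_eq, Subtype.dist_eq, dist_eq_norm, dist_eq_norm, proj_orth_unit hx,
      proj_orth_unit hx]
    exact cap_dist hx y.2.1 z.2.1 y.2.2 z.2.2
  have h1 := hf.hausdorffMeasure_preimage_le (d := (p : ℝ)) (by positivity) (Metric.closedBall 0 1)
  have h2 : f ⁻¹' Metric.closedBall 0 1 = Set.univ := by
    ext y
    simp only [Set.mem_preimage, Metric.mem_closedBall, dist_zero_right, Set.mem_univ, iff_true]
    calc ‖f y‖ ≤ ‖(y : EuclideanSpace ℝ (Fin (p + 1)))‖ :=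
          Submodule.norm_orthogonalProjectionOnto_apply_le _ _
      _ = 1 := y.2.1
      _ ≤ 1 := le_rfl
  rw [h2] at h1
  have h3 := (isometry_subtype_coe (s := U)).hausdorffMeasure_image (d := (p : ℝ))
    (Or.inl (by positivity)) Set.univ
  rw [Set.image_univ, Subtype.range_coe] at h3
  rw [h3]
  refine h1.trans_lt ?_
  refine ENNReal.mul_lt_top (by simp) ?_
  exact (isCompact_closedBall (0 : K) 1).measure_lt_top

lemma sphereHaus_lt_top (p : ℕ) : sphereHaus p < ⊤ := by
  unfold sphereHaus
  refine (isCompact_sphere _ _).measure_lt_top_of_nhdsWithin fun x hx => ?_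
  have hx1 : ‖x‖ = 1 := by simpa using hx
  refine ⟨{y | ‖y‖ = 1 ∧ 1 / 2 < inner ℝ x y}, ?_, cap_finite p x hx1⟩
  have : {y : EuclideanSpace ℝ (Fin (p + 1)) | 1 / 2 < inner ℝ x y} ∈ nhds x := by
    refine (isOpen_lt continuous_const (by fun_prop)).mem_nhds ?_
    simp only [Set.mem_ofPred_eq, real_inner_self_eq_norm_sq, hx1]; norm_num
  filter_upwards [self_mem_nhdsWithin, mem_nhdsWithin_of_mem_nhds this] with y h1 h2
  exact ⟨by simpa using h1, h2⟩

lemma sphereHaus_ne_zero (p : ℕ) : sphereHaus p ≠ 0 := by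
  unfold sphereHaus
  let x : EuclideanSpace ℝ (Fin (p + 1)) := EuclideanSpace.single 0 1
  have hx : ‖x‖ = 1 := by simp [x]
  set K := (Submodule.span ℝ {x})ᗮ with hK
  have : Fact (Module.finrank ℝ (EuclideanSpace ℝ (Fin (p + 1))) = p + 1) := ⟨by simp⟩
  have hx0 : x ≠ 0 := by intro h; simp [h] at hx
  have hfr : Module.finrank ℝ K = p := Submodule.finrank_orthogonal_span_singleton hx0
  have hH : (μH[(p : ℝ)] : Measure K).IsAddHaarMeasure := by
    have := isAddHaarMeasure_hausdorffMeasure (E := K)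
    rwa [hfr] at this
  intro h0
  have h1 := hausdorffMeasure_orthogonalProjectionOnto_le (𝕜 := ℝ) K (p : ℝ) (Metric.sphere 0 1)
    (by positivity)
  have h2 : Metric.ball (0 : K) 1 ⊆ (K.orthogonalProjectionOnto) '' (Metric.sphere 0 1) := by
    intro w hw
    have hw1 : ‖(w : EuclideanSpace ℝ (Fin (p + 1)))‖ < 1 := by simpa using hw
    have hxw : inner ℝ (w : EuclideanSpace ℝ (Fin (p + 1))) x = 0 := by
      rw [real_inner_comm]
      exact Submodule.mem_orthogonal_singleton_iff_inner_right.1 w.2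
    refine ⟨w + √(1 - ‖(w : EuclideanSpace ℝ (Fin (p + 1)))‖ ^ 2) • x, ?_, ?_⟩
    · rw [mem_sphere_zero_iff_norm, ← sq_eq_sq₀ (norm_nonneg _) zero_le_one,
        norm_add_sq_real, norm_smul, hx, inner_smul_right, hxw, Real.norm_eq_abs, mul_one, sq_abs,
        Real.sq_sqrt (by nlinarith [norm_nonneg (w : EuclideanSpace ℝ (Fin (p + 1)))])]
      ring
    · rw [map_add, Submodule.orthogonalProjectionOnto_mem_subspace_eq_self, map_smul]
      have : K.orthogonalProjectionOnto x = 0 := by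
        apply Subtype.ext
        rw [proj_orth_unit hx]
        simp [hx]
      rw [this]; simp
  have h3 : (μH[(p : ℝ)] : Measure K) (Metric.ball 0 1) ≠ 0 :=
    (Metric.measure_ball_pos _ _ one_pos).ne'
  apply h3
  rw [← nonpos_iff_eq_zero]
  exact (measure_mono h2).trans (h1.trans h0.le)

/-- A rotation invariant probability measure -/
def nuM (n : ℕ) : Measure (EuclideanSpace ℝ (Fin n)) :=
  (volume (Metric.ball (0 : EuclideanSpace ℝ (Fin n)) 1))⁻¹ •
    (volume : Measure (EuclideanSpace ℝ (Fin n))).restrict (Metric.ball 0 1)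

instance (n : ℕ) : IsProbabilityMeasure (nuM n) := ⟨by
  simp only [nuM, Measure.smul_apply, Measure.restrict_apply MeasurableSet.univ, Set.univ_inter,
    smul_eq_mul]
  exact ENNReal.inv_mul_cancel (Metric.measure_ball_pos _ _ one_pos).ne' measure_ball_lt_top.ne⟩

lemma nuM_inv {n : ℕ} (g : OG n) (C : Set (EuclideanSpace ℝ (Fin n))) (hC : MeasurableSet C) :
    nuM n (act g ⁻¹' C) = nuM n C := by
  simp only [nuM, Measure.smul_apply]
  rw [Measure.restrict_apply hC, Measure.restrict_apply ((continuous_act_right g).measurable hC)]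
  congr 1
  have h1 : act g ⁻¹' C ∩ Metric.ball 0 1 = act g ⁻¹' (C ∩ Metric.ball 0 1) := by
    ext x; simp [norm_act]
  rw [h1]
  exact (isoOf g).measurePreserving.measure_preimage (hC.inter measurableSet_ball).nullMeasurableSet

lemma nuM_map {n : ℕ} (g : OG n) : (nuM n).map (act g) = nuM n := by
  ext C hC
  rw [Measure.map_apply (continuous_act_right g).measurable hC, nuM_inv g C hC]

/-- normalization -/
def nrm {n : ℕ} (x : EuclideanSpace ℝ (Fin n)) : EuclideanSpace ℝ (Fin n) := ‖x‖⁻¹ • x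

lemma measurable_nrm {n : ℕ} : Measurable (nrm (n := n)) := by
  unfold nrm; fun_prop

lemma nrm_act {n : ℕ} (g : OG n) (x : EuclideanSpace ℝ (Fin n)) :
    nrm (act g x) = act g (nrm x) := by
  simp [nrm, norm_act, act_smul]

lemma measurableSet_unitS {n : ℕ} (W : Submodule ℝ (EuclideanSpace ℝ (Fin n))) :
    MeasurableSet (unitS W) :=
  (W.closed_of_finiteDimensional.inter Metric.isClosed_sphere).measurableSet

lemma unitS_preimage {n : ℕ} {W : Submodule ℝ (EuclideanSpace ℝ (Fin n))} {g : OG n}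
    (hg : g ∈ stab W) : act g ⁻¹' unitS W = unitS W := by
  ext x
  simp [unitS, norm_act, mem_stab.1 hg x]

lemma starProjection_map_act {n : ℕ} (W : Submodule ℝ (EuclideanSpace ℝ (Fin n))) (g : OG n)
    (x : EuclideanSpace ℝ (Fin n)) :
    (W.map ((isoOf g).toLinearEquiv : EuclideanSpace ℝ (Fin n) →ₗ[ℝ] EuclideanSpace ℝ (Fin n))).starProjection x
      = act g (W.starProjection (act g⁻¹ x)) := by
  rw [Submodule.starProjection_map_apply]; rfl

lemma starProjection_stab {n : ℕ} {W : Submodule ℝ (EuclideanSpace ℝ (Fin n))} {g : OG n}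
    (hg : g ∈ stab W) (x : EuclideanSpace ℝ (Fin n)) :
    W.starProjection (act g x) = act g (W.starProjection x) := by
  have h : W.map ((isoOf g).toLinearEquiv : EuclideanSpace ℝ (Fin n) →ₗ[ℝ] EuclideanSpace ℝ (Fin n)) = W := by
    ext y
    constructor
    · rintro ⟨z, hz, rfl⟩
      exact (mem_stab.1 hg z).2 hz
    · intro hy
      refine ⟨act g⁻¹ y, ?_, act_act_inv g y⟩
      rw [SetLike.mem_coe, ← mem_stab.1 hg, act_act_inv]; exact hy
  have := starProjection_map_act W g (act g x)
  rw [act_inv_act] at this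
  rw [← this]
  congr 2
  · exact h.symm

lemma hausdorff_act_image {n : ℕ} (d : ℝ) (g : OG n) (C : Set (EuclideanSpace ℝ (Fin n))) :
    μH[d] (act g '' C) = μH[d] C :=
  (isoOf g).toIsometryEquiv.hausdorffMeasure_image d C

lemma hausdorff_act_preimage {n : ℕ} (d : ℝ) (g : OG n) (C : Set (EuclideanSpace ℝ (Fin n))) :
    μH[d] (act g ⁻¹' C) = μH[d] C :=
  (isoOf g).toIsometryEquiv.hausdorffMeasure_preimage d C

lemma hausdorff_unitS {n p : ℕ} (W : Submodule ℝ (EuclideanSpace ℝ (Fin n)))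
    (hW : Module.finrank ℝ W = p + 1) : μH[(p : ℝ)] (unitS W) = sphereHaus p := by
  let b := (stdOrthonormalBasis ℝ W).reindex (finCongr hW)
  let φ : EuclideanSpace ℝ (Fin (p + 1)) → EuclideanSpace ℝ (Fin n) := fun x => b.repr.symm x
  have hφ : Isometry φ := isometry_subtype_coe.comp b.repr.symm.isometry
  have := hφ.hausdorffMeasure_image (d := (p : ℝ)) (Or.inl (by positivity)) (Metric.sphere 0 1)
  rw [sphereHaus, ← this]
  congr 1
  ext x
  constructor
  · intro hx
    refine ⟨b.repr ⟨x, hx.1⟩, ?_, by simp [φ]⟩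
    have := hx.2
    simp only [mem_sphere_zero_iff_norm] at this ⊢
    rw [b.repr.norm_map]; exact this
  · rintro ⟨y, hy, rfl⟩
    refine ⟨(b.repr.symm y).2, ?_⟩
    simp only [mem_sphere_zero_iff_norm] at hy ⊢
    exact (b.repr.symm.norm_map y).trans hy

/-- Invariance for the restricted Hausdorff measure. -/
lemma hausdorff_restrict_inv {n : ℕ} (d : ℝ) (W : Submodule ℝ (EuclideanSpace ℝ (Fin n)))
    (g : OG n) (hg : g ∈ stab W) (C : Set (EuclideanSpace ℝ (Fin n))) (hC : MeasurableSet C) :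
    (μH[d].restrict (unitS W)) (act g ⁻¹' C) = (μH[d].restrict (unitS W)) C := by
  rw [Measure.restrict_apply hC, Measure.restrict_apply ((continuous_act_right g).measurable hC),
    ← hausdorff_act_preimage d g (C ∩ unitS W), Set.preimage_inter, unitS_preimage hg]

lemma finite_restrict {n p : ℕ} (W : Submodule ℝ (EuclideanSpace ℝ (Fin n)))
    (hW : Module.finrank ℝ W = p + 1) : IsFiniteMeasure (μH[(p : ℝ)].restrict (unitS W)) := by
  constructor
  rw [Measure.restrict_apply MeasurableSet.univ, Set.univ_inter, hausdorff_unitS W hW]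
  exact sphereHaus_lt_top p

lemma nuM_proj_ne {n p : ℕ} (W : Submodule ℝ (EuclideanSpace ℝ (Fin n)))
    (hW : Module.finrank ℝ W = p + 1) : ∀ᵐ x ∂(nuM n), nrm (W.starProjection x) ∈ unitS W := by
  have h1 : Wᗮ ≠ ⊤ := by
    intro h
    have := Submodule.finrank_add_finrank_orthogonal W
    rw [h, finrank_top] at this
    omega
  have h2 : (volume : Measure (EuclideanSpace ℝ (Fin n))) (Wᗮ : Set (EuclideanSpace ℝ (Fin n))) = 0 :=
    Measure.addHaar_submodule _ _ h1
  have h3 : nuM n (Wᗮ : Set (EuclideanSpace ℝ (Fin n))) = 0 := by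
    simp only [nuM, Measure.smul_apply, smul_eq_mul, mul_eq_zero]
    right
    exact le_antisymm ((Measure.restrict_apply_le _ _).trans h2.le) bot_le
  have h4 : ∀ᵐ x ∂(nuM n), x ∉ Wᗮ := by
    rw [ae_iff]; simpa using h3
  filter_upwards [h4] with x hx
  have h5 : W.starProjection x ≠ 0 := by
    intro h; exact hx ((Submodule.starProjection_apply_eq_zero_iff _).1 h)
  refine ⟨W.smul_mem _ (Submodule.starProjection_apply_mem _ _), ?_⟩
  rw [mem_sphere_zero_iff_norm, nrm, norm_smul, norm_inv, norm_norm]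
  exact inv_mul_cancel₀ (norm_ne_zero_iff.2 h5)

/-- the Hausdorff measure on a sphere through projecting the rotation invariant measure -/
lemma sigma_eq {n p : ℕ} (W : Submodule ℝ (EuclideanSpace ℝ (Fin n)))
    (hW : Module.finrank ℝ W = p + 1) (C : Set (EuclideanSpace ℝ (Fin n))) (hC : MeasurableSet C)
    (hCW : C ⊆ unitS W) :
    sigmaMeas p C = nuM n {x | nrm (W.starProjection x) ∈ C} := by
  have := finite_restrict W hW
  have hm : Measurable (fun x => nrm (W.starProjection x)) :=
    measurable_nrm.comp W.starProjection.continuous.measurable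
  have : IsProbabilityMeasure ((nuM n).map (fun x => nrm (W.starProjection x))) :=
    Measure.isProbabilityMeasure_map hm.aemeasurable
  have key := unique_inv W (μH[(p : ℝ)].restrict (unitS W))
    ((nuM n).map (fun x => nrm (W.starProjection x)))
    (by rw [Measure.restrict_apply (measurableSet_unitS W).compl]; simp)
    (by
      rw [Measure.map_apply hm (measurableSet_unitS W).compl]
      exact ae_iff.1 (nuM_proj_ne W hW))
    (fun g hg C hC => hausdorff_restrict_inv _ W g hg C hC)
    (fun g hg C hC => by
      rw [Measure.map_apply hm hC, Measure.map_apply hm ((continuous_act_right g).measurable hC),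
        ← nuM_inv g _ (hm hC)]
      congr 1
      ext x
      simp only [Set.mem_preimage, starProjection_stab hg, nrm_act])
    C hC
  rw [measure_univ, mul_one, Measure.restrict_apply hC, Measure.restrict_apply MeasurableSet.univ,
    Set.univ_inter, Set.inter_eq_left.2 hCW, hausdorff_unitS W hW, Measure.map_apply hm hC] at key
  rw [sigmaMeas, key, ENNReal.mul_div_cancel_right (sphereHaus_ne_zero p) (sphereHaus_lt_top p).ne]
  rfl

/-- `Ek` as a submodule -/
def Es (n k : ℕ) : Submodule ℝ (EuclideanSpace ℝ (Fin n)) where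
  carrier := Ek n k
  add_mem' := by
    intro a b ha hb i hi
    simp [ha i hi, hb i hi]
  zero_mem' := by intro i hi; simp
  smul_mem' := by
    intro c x hx i hi
    simp [hx i hi]

lemma mem_Es {n k : ℕ} {x : EuclideanSpace ℝ (Fin n)} :
    x ∈ Es n k ↔ ∀ i : Fin n, k ≤ (i : ℕ) → x i = 0 := Iff.rfl

lemma finrank_Es {n k : ℕ} (hk : k ≤ n) : Module.finrank ℝ (Es n k) = k := by
  let f : (Fin k → ℝ) →ₗ[ℝ] Es n k :=
    { toFun := fun v => ⟨WithLp.toLp 2 fun i => if h : (i : ℕ) < k then v ⟨i, h⟩ else 0, by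
        intro i hi; simp [not_lt.2 hi]⟩
      map_add' := by
        intro a b; ext i
        by_cases h : (i : ℕ) < k <;> simp [h]
      map_smul' := by
        intro a b; ext i
        by_cases h : (i : ℕ) < k <;> simp [h] }
  have hf : Function.Bijective f := by
    constructor
    · intro a b hab
      ext j
      have := congrArg (fun y : Es n k => (y : EuclideanSpace ℝ (Fin n)) (Fin.castLE hk j)) hab
      simpa [f] using this
    · intro y
      refine ⟨fun j => (y : EuclideanSpace ℝ (Fin n)) (Fin.castLE hk j), ?_⟩
      ext i
      by_cases h : (i : ℕ) < k
      · simp [f, h]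
      · simp [f, h, mem_Es.1 y.2 i (not_lt.1 h)]
  rw [← (LinearEquiv.ofBijective f hf).finrank_eq]; simp

/-- image of a subspace -/
def mapW {n : ℕ} (g : OG n) (W : Submodule ℝ (EuclideanSpace ℝ (Fin n))) :
    Submodule ℝ (EuclideanSpace ℝ (Fin n)) :=
  W.map ((isoOf g).toLinearEquiv : EuclideanSpace ℝ (Fin n) →ₗ[ℝ] EuclideanSpace ℝ (Fin n))

lemma mem_mapW {n : ℕ} {g : OG n} {W : Submodule ℝ (EuclideanSpace ℝ (Fin n))}
    {x : EuclideanSpace ℝ (Fin n)} : x ∈ mapW g W ↔ act g⁻¹ x ∈ W := by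
  constructor
  · rintro ⟨y, hy, rfl⟩
    change act g⁻¹ (act g y) ∈ W
    rw [act_inv_act]; exact hy
  · intro h; exact ⟨_, h, act_act_inv g x⟩

lemma act_mem_mapW {n : ℕ} {g : OG n} {W : Submodule ℝ (EuclideanSpace ℝ (Fin n))}
    {x : EuclideanSpace ℝ (Fin n)} (h : x ∈ W) : act g x ∈ mapW g W := ⟨x, h, rfl⟩

lemma finrank_mapW {n : ℕ} (g : OG n) (W : Submodule ℝ (EuclideanSpace ℝ (Fin n))) :
    Module.finrank ℝ (mapW g W) = Module.finrank ℝ W :=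
  LinearEquiv.finrank_map_eq _ _

/-- the relevant minor -/
def minor {n : ℕ} (m q : ℕ) (hq : m + 1 + q = n) (X : Fin n → EuclideanSpace ℝ (Fin n)) :
    Matrix (Fin q) (Fin q) ℝ :=
  Matrix.of fun i j => X (Fin.castLE (by omega) j) (Fin.cast hq (Fin.natAdd (m + 1) i))

lemma minor_span {n : ℕ} (m q : ℕ) (hq : m + 1 + q = n) (X : Fin n → EuclideanSpace ℝ (Fin n))
    (hX : (minor m q hq X).det ≠ 0) (U : Submodule ℝ (EuclideanSpace ℝ (Fin n)))
    (hU : ∀ j : Fin n, (j : ℕ) < q → X j ∈ U) : U ⊔ Es n (m + 1) = ⊤ := by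
  rw [eq_top_iff]
  intro y _
  have hu : IsUnit (minor m q hq X).det := isUnit_iff_ne_zero.2 hX
  let w : Fin q → ℝ := fun i => y (Fin.cast hq (Fin.natAdd (m + 1) i))
  let c : Fin q → ℝ := (minor m q hq X)⁻¹.mulVec w
  have hc : (minor m q hq X).mulVec c = w := by
    simp only [c, Matrix.mulVec_mulVec, Matrix.mul_nonsing_inv _ hu, Matrix.one_mulVec]
  have hqn : q ≤ n := by omega
  let z : EuclideanSpace ℝ (Fin n) := ∑ j, c j • X (Fin.castLE hqn j)
  have hz : z ∈ U := Submodule.sum_mem _ fun j _ => U.smul_mem _ (hU _ (by simp))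
  have hyz : y - z ∈ Es n (m + 1) := by
    intro i hi
    obtain ⟨i', rfl⟩ : ∃ i' : Fin q, i = Fin.cast hq (Fin.natAdd (m + 1) i') :=
      ⟨⟨i - (m + 1), by omega⟩, by ext; simp; omega⟩
    have h1 := congrFun hc i'
    simp only [Matrix.mulVec, dotProduct, minor, Matrix.of_apply, w] at h1
    have h2 : z (Fin.cast hq (Fin.natAdd (m + 1) i')) = ∑ j, c j *
        X (Fin.castLE hqn j) (Fin.cast hq (Fin.natAdd (m + 1) i')) := by
      simp [z]
    rw [PiLp.sub_apply, h2, ← h1, sub_eq_zero]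
    exact Finset.sum_congr rfl fun j _ => mul_comm _ _
  have : y = z + (y - z) := by abel
  rw [this]
  exact Submodule.add_mem_sup hz hyz

lemma continuous_minor {n : ℕ} (m q : ℕ) (hq : m + 1 + q = n) :
    Continuous (fun X : Fin n → EuclideanSpace ℝ (Fin n) => (minor m q hq X).det) := by
  apply Continuous.matrix_det
  unfold minor
  refine continuous_matrix fun i j => ?_
  simp only [Matrix.of_apply]
  fun_prop

lemma ae_minor {n : ℕ} (m q : ℕ) (hq : m + 1 + q = n) :
    ∀ᵐ X ∂(volume : Measure (Fin n → EuclideanSpace ℝ (Fin n))), (minor m q hq X).det ≠ 0 := by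
  let J : Fin n → EuclideanSpace ℝ (Fin n) := fun j => WithLp.toLp 2 fun i =>
    if (i : ℕ) = m + 1 + j then 1 else 0
  let L : ℝ →ₗ[ℝ] (Fin n → EuclideanSpace ℝ (Fin n)) := LinearMap.toSpanSingleton ℝ _ J
  have hs : MeasurableSet {X : Fin n → EuclideanSpace ℝ (Fin n) | (minor m q hq X).det ≠ 0} :=
    (isOpen_ne_fun (continuous_minor m q hq) continuous_const).measurableSet
  refine ae_mem_of_ae_add_linearMap_mem L (volume : Measure ℝ) volume hs ?_
  intro X
  have key : ∀ t : ℝ, (minor m q hq (X + L t)).det = (-minor m q hq X).charpoly.eval t := by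
    intro t
    rw [Matrix.eval_charpoly]
    congr 1
    ext i j
    simp [minor, L, J, Matrix.scalar_apply, Matrix.diagonal_apply, Fin.ext_iff]
    ring_nf
  have hfin : {t : ℝ | (-minor m q hq X).charpoly.eval t = 0}.Finite :=
    (Matrix.charpoly_monic _).ne_zero |> Polynomial.finite_setOfPred_isRoot
  have h0 : ∀ᵐ t : ℝ, t ∉ {t : ℝ | (-minor m q hq X).charpoly.eval t = 0} := by
    rw [ae_iff]
    simpa using hfin.measure_zero volume
  filter_upwards [h0] with t ht
  change (minor m q hq (X + L t)).det ≠ 0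
  rw [key]
  exact ht

lemma transversal {n l m : ℕ} (hmn : m < n) (hlm : n ≤ l + m + 1)
    (H : Measure (OG n)) [H.IsHaarMeasure] [IsProbabilityMeasure H] :
    ∀ᵐ g ∂H, mapW g (Es n (l + 1)) ⊔ Es n (m + 1) = ⊤ := by
  obtain ⟨q, hq⟩ : ∃ q, m + 1 + q = n := ⟨n - (m + 1), by omega⟩
  have := right_inv H
  have h1 : ∀ g : OG n, ∀ᵐ X ∂(volume : Measure (Fin n → EuclideanSpace ℝ (Fin n))),
      (minor m q hq (fun j => act g (X j))).det ≠ 0 := by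
    intro g
    have hmp : MeasurePreserving (fun X : Fin n → EuclideanSpace ℝ (Fin n) => fun j => act g (X j))
        volume volume :=
      volume_preserving_pi (fun _ => (isoOf g).measurePreserving)
    exact hmp.quasiMeasurePreserving.ae (ae_minor m q hq)
  have hms : MeasurableSet {x : OG n × (Fin n → EuclideanSpace ℝ (Fin n)) |
      (minor m q hq (fun j => act x.1 (x.2 j))).det ≠ 0} := by
    refine (isOpen_ne_fun (Continuous.comp (continuous_minor m q hq) ?_) continuous_const).measurableSet
    refine continuous_pi fun j => ?_
    exact continuous_act.comp (continuous_fst.prodMk ((continuous_apply j).comp continuous_snd))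
  have h2 := (Measure.ae_ae_comm (μ := H) (ν := (volume : Measure (Fin n → EuclideanSpace ℝ (Fin n))))
    (p := fun g X => (minor m q hq (fun j => act g (X j))).det ≠ 0) hms).1
    (Eventually.of_forall h1)
  obtain ⟨X, hX⟩ := h2.exists
  let b := InnerProductSpace.gramSchmidtOrthonormalBasis (𝕜 := ℝ)
    (E := EuclideanSpace ℝ (Fin n)) (ι := Fin n) (by simp) X
  obtain ⟨k, hk⟩ := exists_OG b.repr
  have hkX : ∀ j : Fin n, (j : ℕ) < q → act k (X j) ∈ Es n (l + 1) := by
    intro j hj i hi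
    rw [hk]
    apply InnerProductSpace.gramSchmidtOrthonormalBasis_inv_triangular'
    rw [Fin.lt_def]; omega
  have h3 : ∀ᵐ g ∂H, (minor m q hq (fun j => act (g * k) (X j))).det ≠ 0 :=
    (measurePreserving_mul_right H k).quasiMeasurePreserving.ae hX
  filter_upwards [h3] with g hg
  refine minor_span m q hq _ hg _ fun j hj => ?_
  rw [act_mul]
  exact act_mem_mapW (hkX j hj)

lemma ae_finrank {n l m p : ℕ} (hln : l < n) (hmn : m < n) (hp : p + n = l + m + 1)
    (H : Measure (OG n)) [H.IsHaarMeasure] [IsProbabilityMeasure H] :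
    ∀ᵐ g ∂H, Module.finrank ℝ (mapW g (Es n (l + 1)) ⊓ Es n (m + 1) : Submodule ℝ _) = p + 1 := by
  filter_upwards [transversal (l := l) hmn (by omega) H] with g hg
  have := Submodule.finrank_sup_add_finrank_inf_eq (mapW g (Es n (l + 1))) (Es n (m + 1))
  rw [hg, finrank_top, finrank_mapW, finrank_Es (by omega), finrank_Es (by omega)] at this
  simp only [finrank_euclideanSpace, Fintype.card_fin] at this
  omega

/-- the contraction whose fixed points are the intersection -/
def TT {n : ℕ} (L M : Submodule ℝ (EuclideanSpace ℝ (Fin n))) (g : OG n) :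
    EuclideanSpace ℝ (Fin n) →L[ℝ] EuclideanSpace ℝ (Fin n) :=
  M.starProjection ∘L (mapW g L).starProjection

lemma TT_norm {n : ℕ} (L M : Submodule ℝ (EuclideanSpace ℝ (Fin n))) (g : OG n) :
    ‖TT L M g‖ ≤ 1 := by
  refine (ContinuousLinearMap.opNorm_comp_le _ _).trans ?_
  exact mul_le_one₀ (Submodule.starProjection_norm_le _) (norm_nonneg _)
    (Submodule.starProjection_norm_le _)

lemma TT_fixed {n : ℕ} (L M : Submodule ℝ (EuclideanSpace ℝ (Fin n))) (g : OG n) :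
    (TT L M g).eqLocus (1 : EuclideanSpace ℝ (Fin n) →L[ℝ] EuclideanSpace ℝ (Fin n)) =
      mapW g L ⊓ M := by
  ext x
  have h0 : x ∈ (TT L M g).eqLocus (1 : EuclideanSpace ℝ (Fin n) →L[ℝ] EuclideanSpace ℝ (Fin n))
      ↔ M.starProjection ((mapW g L).starProjection x) = x := Iff.rfl
  rw [h0, Submodule.mem_inf]
  constructor
  · intro h
    have hM : x ∈ M := by rw [← h]; exact Submodule.starProjection_apply_mem _ _
    refine ⟨?_, hM⟩
    rw [Submodule.mem_iff_norm_starProjection]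
    refine le_antisymm (Submodule.norm_starProjection_apply_le _ _) ?_
    conv_lhs => rw [← h]
    exact Submodule.norm_starProjection_apply_le _ _
  · rintro ⟨h1, h2⟩
    rw [Submodule.starProjection_eq_self_iff.2 h1, Submodule.starProjection_eq_self_iff.2 h2]

lemma Continuous.act' {α : Type*} [TopologicalSpace α] {n : ℕ} {f : α → OG n}
    {h : α → EuclideanSpace ℝ (Fin n)} (hf : Continuous f) (hh : Continuous h) :
    Continuous (fun a => act (f a) (h a)) :=
  Continuous.comp (g := fun q : OG n × EuclideanSpace ℝ (Fin n) => act q.1 q.2)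
    (f := fun a => (f a, h a)) continuous_act (Continuous.prodMk hf hh)

lemma continuous_TT {n : ℕ} (L M : Submodule ℝ (EuclideanSpace ℝ (Fin n))) :
    Continuous (fun q : OG n × EuclideanSpace ℝ (Fin n) => TT L M q.1 q.2) := by
  have : (fun q : OG n × EuclideanSpace ℝ (Fin n) => TT L M q.1 q.2) = fun q =>
      M.starProjection (act q.1 (L.starProjection (act q.1⁻¹ q.2))) := by
    ext1 q
    change M.starProjection ((mapW q.1 L).starProjection q.2) = _
    rw [mapW, starProjection_map_act]
  rw [this]
  have hinv : Continuous (fun g : OG n => g⁻¹) := continuous_inv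
  have h1 : Continuous (fun q : OG n × EuclideanSpace ℝ (Fin n) => act q.1⁻¹ q.2) :=
    Continuous.act' (hinv.comp continuous_fst) continuous_snd
  have h2 : Continuous (fun q : OG n × EuclideanSpace ℝ (Fin n) =>
      act q.1 (L.starProjection (act q.1⁻¹ q.2))) :=
    Continuous.act' continuous_fst (L.starProjection.continuous.comp h1)
  exact M.starProjection.continuous.comp h2

lemma measurable_proj {n : ℕ} (L M : Submodule ℝ (EuclideanSpace ℝ (Fin n))) :
    Measurable (fun q : OG n × EuclideanSpace ℝ (Fin n) =>
      (mapW q.1 L ⊓ M).starProjection q.2) := by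
  refine measurable_of_tendsto_metrizable
    (f := fun N (q : OG n × EuclideanSpace ℝ (Fin n)) => birkhoffAverage ℝ (TT L M q.1) id N q.2) ?_ ?_
  · intro N
    apply Continuous.measurable
    have hit : ∀ k : ℕ, Continuous (fun q : OG n × EuclideanSpace ℝ (Fin n) =>
        (TT L M q.1)^[k] q.2) := by
      intro k
      induction k with
      | zero => exact continuous_snd
      | succ k ih =>
        simp only [Function.iterate_succ_apply']
        exact Continuous.comp (g := fun q : OG n × EuclideanSpace ℝ (Fin n) => TT L M q.1 q.2)
          (f := fun q : OG n × EuclideanSpace ℝ (Fin n) => (q.1, (TT L M q.1)^[k] q.2))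
          (continuous_TT L M) (Continuous.prodMk continuous_fst ih)
    have hsum : Continuous (fun q : OG n × EuclideanSpace ℝ (Fin n) =>
        ∑ k ∈ Finset.range N, (TT L M q.1)^[k] q.2) := continuous_finsetSum _ fun k _ => hit k
    exact hsum.const_smul ((N : ℝ)⁻¹)
  · rw [tendsto_pi_nhds]
    rintro ⟨g, x⟩
    have := (TT L M g).tendsto_birkhoffAverage_orthogonalProjection (TT_norm L M g) x
    rw [← Submodule.starProjection_apply] at this
    simp only [TT_fixed] at this
    exact this

/-- the random point on the intersection -/
def yy {n : ℕ} (L M : Submodule ℝ (EuclideanSpace ℝ (Fin n)))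
    (q : OG n × EuclideanSpace ℝ (Fin n)) : EuclideanSpace ℝ (Fin n) :=
  nrm ((mapW q.1 L ⊓ M).starProjection q.2)

lemma measurable_yy {n : ℕ} (L M : Submodule ℝ (EuclideanSpace ℝ (Fin n))) :
    Measurable (yy L M) := measurable_nrm.comp (measurable_proj L M)

/-- the random pair of points -/
def zz {n : ℕ} (L M : Submodule ℝ (EuclideanSpace ℝ (Fin n)))
    (q : OG n × EuclideanSpace ℝ (Fin n)) :
    EuclideanSpace ℝ (Fin n) × EuclideanSpace ℝ (Fin n) := (act q.1⁻¹ (yy L M q), yy L M q)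

lemma measurable_zz {n : ℕ} (L M : Submodule ℝ (EuclideanSpace ℝ (Fin n))) :
    Measurable (zz L M) := by
  have hinv : Continuous (fun g : OG n => g⁻¹) := continuous_inv
  have h1 : Continuous (fun q : OG n × EuclideanSpace ℝ (Fin n) => act q.1⁻¹ q.2) :=
    Continuous.act' (hinv.comp continuous_fst) continuous_snd
  have h2 : Measurable (fun q : OG n × EuclideanSpace ℝ (Fin n) => (q.1, yy L M q)) :=
    Measurable.prodMk measurable_fst (measurable_yy L M)
  exact Measurable.prodMk (h1.measurable.comp h2) (measurable_yy L M)

/-- the law of the random pair of points -/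
def Theta {n : ℕ} (L M : Submodule ℝ (EuclideanSpace ℝ (Fin n))) (H : Measure (OG n)) :
    Measure (EuclideanSpace ℝ (Fin n) × EuclideanSpace ℝ (Fin n)) :=
  (H.prod (nuM n)).map (zz L M)

lemma J_eq {n p : ℕ} (L M : Submodule ℝ (EuclideanSpace ℝ (Fin n)))
    (H : Measure (OG n)) [IsProbabilityMeasure H]
    (hd : ∀ᵐ g ∂H, Module.finrank ℝ (mapW g L ⊓ M : Submodule ℝ _) = p + 1)
    (A B : Set (EuclideanSpace ℝ (Fin n))) (hA : MeasurableSet A) (hB : MeasurableSet B)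
    (hAM : A ⊆ unitS M) (hBL : B ⊆ unitS L) :
    ∫⁻ g, sigmaMeas p (act g '' B ∩ A) ∂H = Theta L M H (B ×ˢ A) := by
  rw [Theta, Measure.map_apply (measurable_zz L M) (hB.prod hA),
    Measure.prod_apply (measurable_zz L M (hB.prod hA))]
  refine lintegral_congr_ae ?_
  filter_upwards [hd] with g hg
  rw [sigma_eq (mapW g L ⊓ M) hg]
  · congr 1
    ext x
    simp only [act_image_eq]
    rfl
  · rw [act_image_eq]
    exact ((continuous_act_right _).measurable hB).inter hA
  · rintro x ⟨⟨y, hy, rfl⟩, hx⟩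
    exact ⟨⟨act_mem_mapW (hBL hy).1, (hAM hx).1⟩, (hAM hx).2⟩

lemma J_inv_B {n p : ℕ} (H : Measure (OG n)) [IsProbabilityMeasure H] [H.IsHaarMeasure]
    (A B : Set (EuclideanSpace ℝ (Fin n))) (k : OG n) :
    ∫⁻ g, sigmaMeas p (act g '' (act k ⁻¹' B) ∩ A) ∂H = ∫⁻ g, sigmaMeas p (act g '' B ∩ A) ∂H := by
  have := right_inv H
  rw [← lintegral_mul_right_eq_self (μ := H) (fun g => sigmaMeas p (act g '' (act k ⁻¹' B) ∩ A)) k]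
  refine lintegral_congr fun g => ?_
  congr 2
  rw [act_image_eq, act_image_eq]
  ext x
  simp only [Set.mem_preimage, mul_inv_rev, act_mul, act_act_inv]

lemma J_inv_A {n p : ℕ} (H : Measure (OG n)) [IsProbabilityMeasure H] [H.IsHaarMeasure]
    (A B : Set (EuclideanSpace ℝ (Fin n))) (k : OG n) :
    ∫⁻ g, sigmaMeas p (act g '' B ∩ act k ⁻¹' A) ∂H = ∫⁻ g, sigmaMeas p (act g '' B ∩ A) ∂H := by
  rw [← lintegral_mul_left_eq_self (μ := H) (fun g => sigmaMeas p (act g '' B ∩ A)) k]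
  refine lintegral_congr fun g => ?_
  unfold sigmaMeas
  rw [← hausdorff_act_preimage _ k (act (k * g) '' B ∩ A)]
  congr 2
  rw [act_image_eq, act_image_eq]
  ext x
  simp only [Set.mem_preimage, mul_inv_rev, act_mul, act_inv_act, Set.mem_inter_iff]

theorem integral_sigma_intersection (l m n p : ℕ) (hl : 0 < l) (hm : 0 < m) (hn : 0 < n)
    (hln : l < n) (hmn : m < n) (hp : p + n = l + m + 1)
    (H : Measure (OG n)) [H.IsHaarMeasure] [IsProbabilityMeasure H]
    (A B : Set (EuclideanSpace ℝ (Fin n)))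
    (hA : MeasurableSet A) (hAsub : A ⊆ Ek n (m + 1) ∩ Metric.sphere 0 1)
    (hB : MeasurableSet B) (hBsub : B ⊆ Ek n (l + 1) ∩ Metric.sphere 0 1) :
    ∫⁻ g, sigmaMeas p (act g '' B ∩ A) ∂H = sigmaMeas l B * sigmaMeas m A := by
  set L := Es n (l + 1) with hL
  set M := Es n (m + 1) with hM
  have hAM : A ⊆ unitS M := hAsub
  have hBL : B ⊆ unitS L := hBsub
  have fL : Module.finrank ℝ L = l + 1 := finrank_Es (by omega)
  have fM : Module.finrank ℝ M = m + 1 := finrank_Es (by omega)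
  have hd : ∀ᵐ g ∂H, Module.finrank ℝ (mapW g L ⊓ M : Submodule ℝ _) = p + 1 :=
    ae_finrank hln hmn hp H
  have mL := measurableSet_unitS L
  have mM := measurableSet_unitS M
  have hTp : IsProbabilityMeasure (Theta L M H) :=
    Measure.isProbabilityMeasure_map (measurable_zz L M).aemeasurable
  have := finite_restrict L fL
  have := finite_restrict M fM
  have J := fun A B hA hB hAM hBL => J_eq (p := p) L M H hd A B hA hB hAM hBL
  -- step 1
  have s1 : Theta L M H (B ×ˢ A) * sphereHaus l = μH[(l : ℝ)] B * Theta L M H (unitS L ×ˢ A) := by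
    have hap : ∀ C, MeasurableSet C → (((Theta L M H).restrict (unitS L ×ˢ A)).map Prod.fst) C
        = Theta L M H ((C ∩ unitS L) ×ˢ A) := by
      intro C hC
      rw [Measure.map_apply measurable_fst hC, Measure.restrict_apply (measurable_fst hC)]
      congr 1
      ext x; simp only [Set.mem_inter_iff, Set.mem_preimage, Set.mem_prod]; tauto
    have key := unique_inv L (((Theta L M H).restrict (unitS L ×ˢ A)).map Prod.fst)
      (μH[(l : ℝ)].restrict (unitS L))
      (by rw [hap _ mL.compl]; simp)
      (by rw [Measure.restrict_apply mL.compl]; simp)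
      (fun g hg C hC => by
        have hC' := (continuous_act_right g).measurable hC
        rw [hap _ hC, hap _ hC',
          ← J A _ hA (hC'.inter mL) hAM Set.inter_subset_right,
          ← J A _ hA (hC.inter mL) hAM Set.inter_subset_right,
          ← J_inv_B H A (C ∩ unitS L) g, Set.preimage_inter, unitS_preimage hg])
      (fun g hg C hC => hausdorff_restrict_inv _ L g hg C hC) B hB
    rwa [hap _ hB, hap _ MeasurableSet.univ, Set.univ_inter, Set.inter_eq_left.2 hBL,
      Measure.restrict_apply hB, Measure.restrict_apply MeasurableSet.univ, Set.univ_inter,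
      Set.inter_eq_left.2 hBL, hausdorff_unitS L fL] at key
  have s2 : Theta L M H (unitS L ×ˢ A) * sphereHaus m
      = μH[(m : ℝ)] A * Theta L M H (unitS L ×ˢ unitS M) := by
    have hap : ∀ C, MeasurableSet C → (((Theta L M H).restrict (unitS L ×ˢ unitS M)).map Prod.snd) C
        = Theta L M H (unitS L ×ˢ (C ∩ unitS M)) := by
      intro C hC
      rw [Measure.map_apply measurable_snd hC, Measure.restrict_apply (measurable_snd hC)]
      congr 1
      ext x; simp only [Set.mem_inter_iff, Set.mem_preimage, Set.mem_prod]; tauto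
    have key := unique_inv M (((Theta L M H).restrict (unitS L ×ˢ unitS M)).map Prod.snd)
      (μH[(m : ℝ)].restrict (unitS M))
      (by rw [hap _ mM.compl]; simp)
      (by rw [Measure.restrict_apply mM.compl]; simp)
      (fun g hg C hC => by
        have hC' := (continuous_act_right g).measurable hC
        rw [hap _ hC, hap _ hC',
          ← J _ _ (hC'.inter mM) mL Set.inter_subset_right subset_rfl,
          ← J _ _ (hC.inter mM) mL Set.inter_subset_right subset_rfl,
          ← J_inv_A H (C ∩ unitS M) (unitS L) g, Set.preimage_inter, unitS_preimage hg])
      (fun g hg C hC => hausdorff_restrict_inv _ M g hg C hC) A hA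
    rwa [hap _ hA, hap _ MeasurableSet.univ, Set.univ_inter, Set.inter_eq_left.2 hAM,
      Measure.restrict_apply hA, Measure.restrict_apply MeasurableSet.univ, Set.univ_inter,
      Set.inter_eq_left.2 hAM, hausdorff_unitS M fM] at key
  have s3 : Theta L M H (unitS L ×ˢ unitS M) = 1 := by
    rw [← J _ _ mM mL subset_rfl subset_rfl]
    have : ∀ᵐ g ∂H, sigmaMeas p (act g '' unitS L ∩ unitS M) = 1 := by
      filter_upwards [hd] with g hg
      have : act g '' unitS L ∩ unitS M = unitS (mapW g L ⊓ M) := by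
        ext x
        rw [act_image_eq]
        simp only [unitS, Set.mem_inter_iff, Set.mem_preimage, SetLike.mem_coe, Submodule.mem_inf,
          mem_mapW, mem_sphere_zero_iff_norm, norm_act]
        tauto
      rw [this, sigmaMeas, hausdorff_unitS _ hg]
      exact ENNReal.div_self (sphereHaus_ne_zero p) (sphereHaus_lt_top p).ne
    rw [lintegral_congr_ae this]; simp
  rw [s3, mul_one] at s2
  rw [J A B hA hB hAM hBL]
  have t1 : Theta L M H (B ×ˢ A)
      = (μH[(l:ℝ)] B * Theta L M H (unitS L ×ˢ A)) / sphereHaus l :=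
    (ENNReal.eq_div_iff (sphereHaus_ne_zero l) (sphereHaus_lt_top l).ne).2
      (by rw [mul_comm]; exact s1)
  have t2 : Theta L M H (unitS L ×ˢ A) = μH[(m:ℝ)] A / sphereHaus m :=
    (ENNReal.eq_div_iff (sphereHaus_ne_zero m) (sphereHaus_lt_top m).ne).2
      (by rw [mul_comm]; exact s2)
  rw [t1, t2, sigmaMeas, sigmaMeas, div_eq_mul_inv, div_eq_mul_inv, div_eq_mul_inv]
  ring
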